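/- arXiv:2507.06759 — 2 statements merged into one kernel-verified Lean document; each statement's English description precedes it below -/
import Mathlib

section
/- Let s > 0 and let μ be an s-concave probability measure on ℝⁿ whose barycenter g_μ exists. Fix a unit vector u and let H⁻ = {x : ⟨x,u⟩ ≤ ⟨g_μ,u⟩}. Then μ(H⁻) ≥ (1/(1+s))^{1/s}. -/
open MeasureTheory Set Pointwise
open scoped RealInnerProductSpace

lemma aux_meas (ν : Measure ℝ) [IsProbabilityMeasure ν] (t : ℝ) (ht : 0 ≤ t) :
    ν.real {r | ν.real (Iic r) ≤ t} ≤ t := by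
  have hmono : Monotone (fun r => ν.real (Iic r)) := fun a b hab =>
    measureReal_mono (Iic_subset_Iic.2 hab)
  have hm : MeasurableSet {r | ν.real (Iic r) ≤ t} := measurableSet_le hmono.measurable measurable_const
  have : ν {r | ν.real (Iic r) ≤ t} ≤ ENNReal.ofReal t := by
    rw [hm.measure_eq_iSup_isCompact]
    refine iSup₂_le fun K hK => iSup_le fun hc => ?_
    rcases K.eq_empty_or_nonempty with rfl | hne
    · simp
    · have h1 := hc.sSup_mem hne
      have h2 : K ⊆ Iic (sSup K) := fun x hx => le_csSup hc.bddAbove hx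
      have h3 : ν.real (Iic (sSup K)) ≤ t := hK h1
      refine (measure_mono h2).trans ?_
      rw [ENNReal.le_ofReal_iff_toReal_le (measure_ne_top _ _) ht]
      exact h3
  exact ENNReal.toReal_le_of_le_ofReal ht this

lemma aux_int (ν : Measure ℝ) [IsProbabilityMeasure ν] (s : ℝ) (hs : 0 < s) :
    Integrable (fun r => ν.real (Iic r) ^ s) ν ∧ 1 / (1 + s) ≤ ∫ r, ν.real (Iic r) ^ s ∂ν := by
  have hmono : Monotone (fun r => ν.real (Iic r)) := fun a b hab =>
    measureReal_mono (Iic_subset_Iic.2 hab)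
  have hmono2 : Monotone (fun r => ν.real (Iic r) ^ s) := fun a b hab =>
    Real.rpow_le_rpow measureReal_nonneg (hmono hab) hs.le
  have hle : ∀ r, ν.real (Iic r) ^ s ≤ 1 := fun r =>
    Real.rpow_le_one measureReal_nonneg measureReal_le_one hs.le
  have hnn : ∀ r, 0 ≤ ν.real (Iic r) ^ s := fun r => Real.rpow_nonneg measureReal_nonneg _
  have hI : Integrable (fun r => ν.real (Iic r) ^ s) ν := by
    refine Integrable.of_bound hmono2.measurable.aestronglyMeasurable 1 (ae_of_all _ fun r => ?_)
    rw [Real.norm_of_nonneg (hnn r)]; exact hle r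
  refine ⟨hI, ?_⟩
  rw [hI.integral_eq_integral_Ioc_meas_le (M := 1) (ae_of_all _ hnn) (ae_of_all _ hle),
    ← intervalIntegral.integral_of_le zero_le_one]
  have hcalc : ∫ t in (0:ℝ)..1, (1 - t ^ (1 / s)) = 1 / (1 + s) := by
    have h1 : (-1:ℝ) < 1 / s := by have : 0 < 1 / s := by positivity
                                   linarith
    rw [intervalIntegral.integral_sub (by simp) (intervalIntegral.intervalIntegrable_rpow' h1),
      integral_rpow (Or.inl h1)]
    have : (1 / s + 1) ≠ 0 := by positivity
    rw [Real.zero_rpow this]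
    simp
    field_simp
    ring
  rw [← hcalc]
  refine intervalIntegral.integral_mono_on zero_le_one ?_ ?_ ?_
  · have h1 : (-1:ℝ) < 1 / s := by have : 0 < 1 / s := by positivity
                                   linarith
    exact (by simp : IntervalIntegrable (fun _ => (1:ℝ)) volume 0 1).sub
      (intervalIntegral.intervalIntegrable_rpow' h1)
  · refine AntitoneOn.intervalIntegrable (Antitone.antitoneOn ?_ _)
    intro a b hab
    exact measureReal_mono (fun x hx => le_trans hab hx)
  · intro t ht
    have h0 := aux_meas ν (t ^ (1 / s)) (Real.rpow_nonneg ht.1 _)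
    have hm : MeasurableSet {r | ν.real (Iic r) ≤ t ^ (1 / s)} :=
      measurableSet_le hmono.measurable measurable_const
    have h2 : ν.real {r | ν.real (Iic r) ≤ t ^ (1 / s)}ᶜ = 1 - _ := probReal_compl_eq_one_sub hm
    have h3 : ν.real {r | ν.real (Iic r) ≤ t ^ (1 / s)}ᶜ ≤ ν.real {a | t ≤ ν.real (Iic a) ^ s} := by
      refine measureReal_mono fun r hr => ?_
      have hr' : t ^ (1 / s) < ν.real (Iic r) := not_le.1 hr
      have := Real.rpow_le_rpow (Real.rpow_nonneg ht.1 _) hr'.le hs.le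
      rwa [← Real.rpow_mul ht.1, one_div_mul_cancel hs.ne', Real.rpow_one] at this
    linarith

lemma aux_oneD (ν : Measure ℝ) [IsProbabilityMeasure ν] (s : ℝ) (hs : 0 < s)
    (hconc : ∀ a b, 0 < ν.real (Iic a) → 0 < ν.real (Iic b) → ∀ l ∈ Icc (0:ℝ) 1,
      (1 - l) * ν.real (Iic a) ^ s + l * ν.real (Iic b) ^ s ≤ ν.real (Iic ((1 - l) * a + l * b)) ^ s)
    (hint : Integrable (fun y : ℝ => y) ν) (c : ℝ) (hc : c = ∫ y, y ∂ν) :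
    1 / (1 + s) ≤ ν.real (Iic c) ^ s := by
  obtain ⟨hI, hlow⟩ := aux_int ν s hs
  have hmono : Monotone (fun r => ν.real (Iic r)) := fun a b hab =>
    measureReal_mono (Iic_subset_Iic.2 hab)
  have hae : ∀ᵐ y ∂ν, 0 < ν.real (Iic y) := by
    have h := aux_meas ν 0 le_rfl
    have h' : ν {r | ν.real (Iic r) ≤ 0} = 0 := by
      rw [← measureReal_eq_zero_iff]; exact le_antisymm h measureReal_nonneg
    rw [ae_iff]; simpa only [not_lt] using h'
  have hc0 : 0 < ν.real (Iic c) := by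
    have := measure_le_integral_pos hint
    rw [← hc] at this
    exact ENNReal.toReal_pos this.ne' (measure_ne_top _ _)
  by_cases hex : ∃ y0 < c, 0 < ν.real (Iic y0)
  · obtain ⟨y0, hy0, hF0⟩ := hex
    set G : ℝ → ℝ := fun r => ν.real (Iic r) ^ s with hG
    -- slope inequality
    have key : ∀ x y, x < c → c < y → 0 < ν.real (Iic x) →
        (G y - G c) / (y - c) ≤ (G c - G x) / (c - x) := by
      intro x y hx hy hFx
      have hFy : 0 < ν.real (Iic y) := hc0.trans_le (hmono hy.le)
      have hd : 0 < y - x := by linarith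
      have h := hconc x y hFx hFy ((c - x) / (y - x))
        ⟨div_nonneg (by linarith) hd.le, (div_le_one hd).2 (by linarith)⟩
      have e : (1 - (c - x) / (y - x)) * x + (c - x) / (y - x) * y = c := by
        field_simp; ring
      rw [e] at h
      change (1 - (c - x) / (y - x)) * G x + (c - x) / (y - x) * G y ≤ G c at h
      have h2 : (y - c) * G x + (c - x) * G y ≤ (y - x) * G c := by
        have := mul_le_mul_of_nonneg_left h hd.le
        have e2 : (y - x) * ((1 - (c - x) / (y - x)) * G x + (c - x) / (y - x) * G y)
          = (y - c) * G x + (c - x) * G y := by field_simp; ring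
        linarith
      rw [div_le_div_iff₀ (by linarith) (by linarith)]
      nlinarith
    set m := sSup ((fun y => (G y - G c) / (y - c)) '' Ioi c) with hm
    have hbdd : BddAbove ((fun y => (G y - G c) / (y - c)) '' Ioi c) := by
      refine ⟨(G c - G y0) / (c - y0), ?_⟩
      rintro _ ⟨y, hy, rfl⟩
      exact key y0 y hy0 hy hF0
    have hsup : ∀ y, 0 < ν.real (Iic y) → G y ≤ G c + m * (y - c) := by
      intro y hFy
      rcases lt_trichotomy y c with h | h | h
      · have : m ≤ (G c - G y) / (c - y) := by
          refine csSup_le (nonempty_Ioi.image _) ?_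
          rintro _ ⟨z, hz, rfl⟩
          exact key y z h hz hFy
        rw [le_div_iff₀ (by linarith)] at this
        linarith
      · subst h; simp
      · have : (G y - G c) / (y - c) ≤ m := le_csSup hbdd ⟨y, h, rfl⟩
        rw [div_le_iff₀ (by linarith)] at this
        linarith
    have hi2 : Integrable (fun y => m * (y - c)) ν := (hint.sub (integrable_const c)).const_mul m
    have h1 : ∫ y, G y ∂ν ≤ ∫ y, (G c + m * (y - c)) ∂ν :=
      integral_mono_ae hI ((integrable_const _).add hi2) (hae.mono hsup)
    rw [integral_add (integrable_const _) hi2, integral_const_mul,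
      integral_sub hint (integrable_const c), ← hc] at h1
    simp at h1
    exact hlow.trans h1
  · push Not at hex
    have hge : ∀ᵐ y ∂ν, c ≤ y := by
      filter_upwards [hae] with y hy
      by_contra hlt
      exact absurd (hex y (not_le.1 hlt)) (not_le.2 hy)
    have hz : ∫ y, (y - c) ∂ν = 0 := by
      rw [integral_sub hint (integrable_const c), ← hc]; simp
    rw [integral_eq_zero_iff_of_nonneg_ae (hge.mono fun y hy => sub_nonneg.2 hy)
      (hint.sub (integrable_const c))] at hz
    have h1 : ν.real (Iic c) = 1 := by
      have : ν (Iic c) = 1 := by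
        rw [prob_compl_eq_zero_iff measurableSet_Iic |>.symm]
        change ∀ᵐ y ∂ν, y ∈ Iic c
        filter_upwards [hz] with y hy
        exact (sub_eq_zero.1 hy).le
      simp [Measure.real, this]
    rw [h1, Real.one_rpow, div_le_one (by linarith)]
    linarith

/-- Grünbaum's inequality for `s`-concave probability measures, `s > 0`:
`μ(H⁻) ≥ (1/(1+s))^{1/s}` for the half-space `H⁻` below the hyperplane through the
barycenter with unit normal `u`. -/
theorem stmt_11 (n : ℕ) (s : ℝ) (hs : 0 < s)
    (μ : Measure (EuclideanSpace ℝ (Fin n))) [IsProbabilityMeasure μ]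
    (hconc : ∀ (A B : Set (EuclideanSpace ℝ (Fin n))), MeasurableSet A → MeasurableSet B →
      0 < μ A → 0 < μ B → ∀ lam ∈ Icc (0:ℝ) 1,
        ((1 - lam) * (μ A).toReal ^ s + lam * (μ B).toReal ^ s) ^ (1 / s)
          ≤ (μ ((1 - lam) • A + lam • B)).toReal)
    (hbar : Integrable (fun x : EuclideanSpace ℝ (Fin n) => x) μ)
    (g : EuclideanSpace ℝ (Fin n)) (hg : g = ∫ x, x ∂μ)
    (u : EuclideanSpace ℝ (Fin n)) (hu : ‖u‖ = 1) :
    (1 / (1 + s)) ^ (1 / s) ≤ (μ {x | ⟪x, u⟫ ≤ ⟪g, u⟫}).toReal := by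
  have hmeas : Measurable (fun x : EuclideanSpace ℝ (Fin n) => (⟪x, u⟫ : ℝ)) := by fun_prop
  have hF : ∀ r, (μ.map (fun x => (⟪x, u⟫ : ℝ))).real (Iic r) = (μ {x | ⟪x, u⟫ ≤ r}).toReal := by
    intro r
    rw [Measure.real, Measure.map_apply hmeas measurableSet_Iic]; rfl
  haveI : IsProbabilityMeasure (μ.map (fun x => (⟪x, u⟫ : ℝ))) :=
    Measure.isProbabilityMeasure_map hmeas.aemeasurable
  have hI : Integrable (fun x : EuclideanSpace ℝ (Fin n) => (⟪x, u⟫ : ℝ)) μ := hbar.inner_const u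
  have h := aux_oneD (μ.map (fun x => (⟪x, u⟫ : ℝ))) s hs ?_ ?_ ⟪g, u⟫ ?_
  · rw [hF] at h
    have h' := Real.rpow_le_rpow (by positivity) h (by positivity : (0:ℝ) ≤ 1 / s)
    rwa [← Real.rpow_mul ENNReal.toReal_nonneg, mul_one_div_cancel hs.ne', Real.rpow_one] at h'
  · intro a b ha hb l hl
    rw [hF] at ha hb
    rw [hF, hF, hF]
    have hms : ∀ r : ℝ, MeasurableSet {x : EuclideanSpace ℝ (Fin n) | ⟪x, u⟫ ≤ r} := fun r =>
      hmeas measurableSet_Iic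
    have h1 := hconc _ _ (hms a) (hms b) (ENNReal.toReal_pos_iff.1 ha).1
      (ENNReal.toReal_pos_iff.1 hb).1 l hl
    have hsub : (1 - l) • {x : EuclideanSpace ℝ (Fin n) | ⟪x, u⟫ ≤ a} + l • {x | ⟪x, u⟫ ≤ b}
        ⊆ {x | ⟪x, u⟫ ≤ (1 - l) * a + l * b} := by
      rintro _ ⟨_, ⟨x, hx, rfl⟩, _, ⟨y, hy, rfl⟩, rfl⟩
      simp only [mem_setOf_eq] at hx hy ⊢
      simp only [inner_add_left, real_inner_smul_left]
      exact add_le_add (mul_le_mul_of_nonneg_left hx (by linarith [hl.2]))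
        (mul_le_mul_of_nonneg_left hy hl.1)
    have h2 := h1.trans (ENNReal.toReal_mono (measure_ne_top _ _) (measure_mono hsub))
    have hnn : 0 ≤ (1 - l) * (μ {x : EuclideanSpace ℝ (Fin n) | ⟪x, u⟫ ≤ a}).toReal ^ s
        + l * (μ {x : EuclideanSpace ℝ (Fin n) | ⟪x, u⟫ ≤ b}).toReal ^ s :=
      add_nonneg (mul_nonneg (by linarith [hl.2]) (by positivity)) (mul_nonneg hl.1 (by positivity))
    have h3 := Real.rpow_le_rpow (Real.rpow_nonneg hnn _) h2 hs.le
    rwa [← Real.rpow_mul hnn, one_div_mul_cancel hs.ne', Real.rpow_one] at h3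
  · exact (integrable_map_measure (by fun_prop) hmeas.aemeasurable).2 hI
  · rw [integral_map hmeas.aemeasurable (by fun_prop), hg, real_inner_comm, ← integral_inner hbar]
    simp only [real_inner_comm]
end

section
/- Let μ be a log-concave probability measure on ℝⁿ whose barycenter g_μ exists. Fix a unit vector u and let H⁻ = {x : ⟨x,u⟩ ≤ ⟨g_μ,u⟩}. Then μ(H⁻) ≥ 1/e. -/
open MeasureTheory Set Pointwise
open scoped RealInnerProductSpace

lemma aux_lower (ν : Measure ℝ) [IsProbabilityMeasure ν] (s : ℝ) (hs : 0 ≤ s) :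
    ν {t | ν.real (Iic t) ≤ s} ≤ ENNReal.ofReal s := by
  have hmono : Monotone (fun t => ν.real (Iic t)) := fun a b hab =>
    measureReal_mono (Iic_subset_Iic.2 hab)
  have hmeas : MeasurableSet {t | ν.real (Iic t) ≤ s} :=
    measurableSet_le hmono.measurable measurable_const
  by_contra! h
  obtain ⟨K, hKs, hK, hlt⟩ := hmeas.exists_lt_isCompact h
  rcases K.eq_empty_or_nonempty with rfl | hne
  · simp at hlt
  obtain ⟨t, ht⟩ := hK.exists_isGreatest hne
  have h1 : ν K ≤ ν (Iic t) := measure_mono (fun x hx => ht.2 hx)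
  have h2 : ν.real (Iic t) ≤ s := hKs ht.1
  have h3 : ν (Iic t) ≤ ENNReal.ofReal s := by
    rw [← ofReal_measureReal]
    exact ENNReal.ofReal_le_ofReal h2
  exact absurd hlt (not_lt.2 (h1.trans h3))

lemma aux_lint (ν : Measure ℝ) [IsProbabilityMeasure ν] :
    ∫⁻ t, ENNReal.ofReal (-Real.log (ν.real (Iic t))) ∂ν ≤ 1 := by
  have hmono : Monotone (fun t => ν.real (Iic t)) := fun a b hab =>
    measureReal_mono (Iic_subset_Iic.2 hab)
  rw [lintegral_eq_lintegral_meas_le]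
  · calc ∫⁻ r in Ioi (0:ℝ), ν {a | r ≤ -Real.log (ν.real (Iic a))}
        ≤ ∫⁻ r in Ioi (0:ℝ), ENNReal.ofReal (Real.exp (-r)) := by
          refine lintegral_mono fun r => ?_
          refine le_trans (measure_mono ?_) (aux_lower ν _ (Real.exp_pos (-r)).le)
          intro a ha
          simp only [mem_ofPred_eq] at ha ⊢
          rcases (measureReal_nonneg (μ := ν) (s := Iic a)).eq_or_lt with h0 | h0
          · rw [← h0]; exact (Real.exp_pos _).le
          · rw [← Real.log_le_iff_le_exp h0]; linarith
      _ = 1 := by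
          rw [← ofReal_integral_eq_lintegral_ofReal]
          · rw [integral_exp_neg_Ioi_zero]; simp
          · exact integrableOn_exp_neg_Ioi 0
          · exact Filter.Eventually.of_forall fun r => (Real.exp_pos _).le
  · refine Filter.Eventually.of_forall fun t => ?_
    have := Real.log_nonpos (measureReal_nonneg (μ := ν) (s := Iic t)) measureReal_le_one
    simpa using this
  · exact (Real.measurable_log.comp hmono.measurable).neg.aemeasurable

lemma aux_real (ν : Measure ℝ) [IsProbabilityMeasure ν]
    (hc : ∀ a b : ℝ, 0 < ν.real (Iic a) → 0 < ν.real (Iic b) → ∀ l ∈ Icc (0:ℝ) 1,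
      ν.real (Iic a) ^ (1 - l) * ν.real (Iic b) ^ l ≤ ν.real (Iic ((1 - l) * a + l * b)))
    (hi : Integrable (fun x : ℝ => x) ν) (h0 : ∫ x, x ∂ν = 0) :
    (Real.exp 1)⁻¹ ≤ ν.real (Iic 0) := by
  have hmono : Monotone (fun t => ν.real (Iic t)) := fun a b hab =>
    measureReal_mono (Iic_subset_Iic.2 hab)
  by_cases hneg : ∃ t < 0, 0 < ν.real (Iic t)
  swap
  · push Not at hneg
    have hz : ∀ t < 0, ν (Iic t) = 0 := fun t ht => by
      have := le_antisymm (hneg t ht) measureReal_nonneg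
      simpa [measureReal_def, ENNReal.toReal_eq_zero_iff] using this
    have hIio : ν (Iio 0) = 0 := by
      have : Iio (0:ℝ) = ⋃ n : ℕ, Iic (-(1 / ((n:ℝ) + 1))) := by
        ext x
        simp only [mem_Iio, mem_iUnion, mem_Iic]
        constructor
        · intro hx
          obtain ⟨n, hn⟩ := exists_nat_one_div_lt (neg_pos.2 hx)
          exact ⟨n, by linarith⟩
        · rintro ⟨n, hn⟩
          have : 0 < 1 / ((n:ℝ) + 1) := by positivity
          linarith
      rw [this, measure_iUnion_null_iff]
      intro n
      apply hz
      have : 0 < 1 / ((n:ℝ) + 1) := by positivity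
      linarith
    have hnn : 0 ≤ᵐ[ν] (fun x : ℝ => x) := by
      rw [Filter.EventuallyLE, ae_iff]
      convert hIio using 2
      ext x; simp
    have := (integral_eq_zero_iff_of_nonneg_ae hnn hi).1 h0
    have h1 : ν (Iic 0) = 1 := by
      rw [← prob_compl_eq_zero_iff measurableSet_Iic]
      have h2 : ∀ᵐ x ∂ν, x ∈ Iic (0:ℝ) := by
        filter_upwards [this] with x hx
        exact le_of_eq hx
      exact h2
    rw [measureReal_def, h1, ENNReal.toReal_one]
    exact inv_le_one_of_one_le₀ (Real.one_le_exp zero_le_one)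
  obtain ⟨t₀, ht₀, hpos⟩ := hneg
  set S : Set ℝ := {t | 0 < ν.real (Iic t)} with hS
  have hup : ∀ a b, a ∈ S → a ≤ b → b ∈ S := fun a b ha hab => lt_of_lt_of_le ha (hmono hab)
  have hint : (0:ℝ) ∈ interior S := by
    rw [mem_interior_iff_mem_nhds]
    exact Filter.mem_of_superset (Ici_mem_nhds ht₀) (fun b hb => hup t₀ b hpos hb)
  have hcvx : ConvexOn ℝ S (fun t => -Real.log (ν.real (Iic t))) := by
    have hSc : Convex ℝ S := by
      apply Set.OrdConnected.convex
      exact ⟨fun a ha b _ x hx => hup a x ha hx.1⟩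
    refine ⟨hSc, ?_⟩
    intro x hx y hy a b ha hb hab
    have hxy := hSc hx hy ha hb hab
    have := hc x y hx hy b ⟨hb, by linarith⟩
    have ha' : 1 - b = a := by linarith
    rw [ha'] at this
    have hx' : 0 < ν.real (Iic x) := hx
    have hy' : 0 < ν.real (Iic y) := hy
    have hl := Real.log_le_log (by positivity) this
    rw [Real.log_mul (by positivity) (by positivity), Real.log_rpow hx', Real.log_rpow hy'] at hl
    simp only [smul_eq_mul]
    linarith
  set φ : ℝ → ℝ := fun t => -Real.log (ν.real (Iic t)) with hφ
  have hsub : ∃ c : ℝ, ∀ t ∈ S, φ 0 + c * t ≤ φ t := by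
    refine ⟨derivWithin φ (Ioi 0) 0, fun t ht => ?_⟩
    rcases lt_trichotomy t 0 with h | h | h
    · have h1 := hcvx.slope_le_leftDeriv_of_mem_interior ht hint h
      have h2 := h1.trans (hcvx.leftDeriv_le_rightDeriv_of_mem_interior hint)
      rw [slope_def_field, div_le_iff₀ (by linarith)] at h2
      linarith
    · simp [h]
    · have h1 := hcvx.rightDeriv_le_slope_of_mem_interior hint ht h
      rw [slope_def_field, le_div_iff₀ (by linarith)] at h1
      linarith
  obtain ⟨c, hcs⟩ := hsub
  have hae : ∀ᵐ t ∂ν, t ∈ S := by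
    have := aux_lower ν 0 le_rfl
    rw [ENNReal.ofReal_zero, nonpos_iff_eq_zero] at this
    rw [ae_iff]
    simpa [hS] using this
  have hφ0 : ∀ t, 0 ≤ φ t := fun t => by
    have := Real.log_nonpos (measureReal_nonneg (μ := ν) (s := Iic t)) measureReal_le_one
    simp only [hφ]; linarith
  have hφm : Measurable φ := (Real.measurable_log.comp hmono.measurable).neg
  have hlin := aux_lint ν
  have hφi : Integrable φ ν := by
    refine ⟨hφm.aestronglyMeasurable, ?_⟩
    rw [hasFiniteIntegral_iff_ofReal (Filter.Eventually.of_forall hφ0)]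
    exact lt_of_le_of_lt hlin ENNReal.one_lt_top
  have hφle : ∫ t, φ t ∂ν ≤ 1 := by
    rw [integral_eq_lintegral_of_nonneg_ae (Filter.Eventually.of_forall hφ0)
      hφm.aestronglyMeasurable]
    exact ENNReal.toReal_le_of_le_ofReal zero_le_one (by simpa using hlin)
  have hge : ∫ t, (φ 0 + c * t) ∂ν ≤ ∫ t, φ t ∂ν := by
    apply integral_mono_ae ((integrable_const _).add (hi.const_mul c)) hφi
    filter_upwards [hae] with t ht using hcs t ht
  rw [integral_add (integrable_const _) (hi.const_mul c), integral_const_mul, h0] at hge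
  simp only [integral_const, probReal_univ, one_smul, mul_zero, add_zero] at hge
  have hF : 0 < ν.real (Iic 0) := hup t₀ 0 hpos ht₀.le
  rw [← Real.exp_neg, ← Real.le_log_iff_exp_le hF]
  have : φ 0 = -Real.log (ν.real (Iic 0)) := rfl
  linarith

/-- Grünbaum's inequality for log-concave probability measures:
`μ(H⁻) ≥ 1/e` for the half-space `H⁻` below the hyperplane through the barycenter
with unit normal `u`. -/
theorem stmt_12 (n : ℕ)
    (μ : Measure (EuclideanSpace ℝ (Fin n))) [IsProbabilityMeasure μ]
    (hconc : ∀ (A B : Set (EuclideanSpace ℝ (Fin n))), MeasurableSet A → MeasurableSet B →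
      0 < μ A → 0 < μ B → ∀ lam ∈ Icc (0:ℝ) 1,
        (μ A).toReal ^ (1 - lam) * (μ B).toReal ^ lam
          ≤ (μ ((1 - lam) • A + lam • B)).toReal)
    (hbar : Integrable (fun x : EuclideanSpace ℝ (Fin n) => x) μ)
    (g : EuclideanSpace ℝ (Fin n)) (hg : g = ∫ x, x ∂μ)
    (u : EuclideanSpace ℝ (Fin n)) (hu : ‖u‖ = 1) :
    (Real.exp 1)⁻¹ ≤ (μ {x | ⟪x, u⟫ ≤ ⟪g, u⟫}).toReal := by
  have hm : Measurable (fun x : EuclideanSpace ℝ (Fin n) => ⟪x, u⟫ - ⟪g, u⟫) := by fun_prop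
  set ν : Measure ℝ := μ.map (fun x => ⟪x, u⟫ - ⟪g, u⟫) with hν
  haveI : IsProbabilityMeasure ν := Measure.isProbabilityMeasure_map hm.aemeasurable
  have hF : ∀ t, ν.real (Iic t) = (μ {x | ⟪x, u⟫ - ⟪g, u⟫ ≤ t}).toReal := fun t => by
    rw [measureReal_def, hν, Measure.map_apply hm measurableSet_Iic]
    rfl
  have hii : Integrable (fun x : EuclideanSpace ℝ (Fin n) => ⟪x, u⟫) μ := hbar.inner_const u
  have hmain := aux_real ν ?_ ?_ ?_
  · rw [hF] at hmain
    simpa [sub_nonpos] using hmain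
  · intro a b ha hb l hl
    rw [hF] at ha hb
    rw [hF, hF, hF]
    refine (hconc _ _ (hm measurableSet_Iic) (hm measurableSet_Iic)
      (ENNReal.toReal_pos_iff.1 ha).1 (ENNReal.toReal_pos_iff.1 hb).1 l hl).trans ?_
    refine ENNReal.toReal_mono (measure_ne_top _ _) (measure_mono ?_)
    rintro _ ⟨_, ⟨x, hx, rfl⟩, _, ⟨y, hy, rfl⟩, rfl⟩
    simp only [mem_preimage, mem_Iic, mem_ofPred_eq] at hx hy ⊢
    simp only [inner_add_left, real_inner_smul_left]
    have h1 := mul_le_mul_of_nonneg_left hx (sub_nonneg.2 hl.2)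
    have h2 := mul_le_mul_of_nonneg_left hy hl.1
    linarith
  · rw [hν, integrable_map_measure (by fun_prop) hm.aemeasurable]
    exact hii.sub (integrable_const _)
  · rw [hν, integral_map hm.aemeasurable (by fun_prop),
      integral_sub hii (integrable_const _)]
    have : ∫ x, ⟪x, u⟫ ∂μ = ⟪g, u⟫ := by
      have h := integral_inner (𝕜 := ℝ) hbar u
      rw [← hg, real_inner_comm] at h
      rw [← h]
      exact integral_congr_ae (Filter.Eventually.of_forall fun x => real_inner_comm _ _)
    simp [this]
end
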